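/- Let m, n ≥ 1, X : Matrix (Fin m) (Fin n) ℝ, and β, α > 0, and let F(μ, ν) = ∑ i, ∑ j, μ i * X i j * ν j + β * H(μ) − α * H(ν). A pair (μ*, ν*) ∈ stdSimplex ℝ (Fin m) × stdSimplex ℝ (Fin n) is a saddle point of F (i.e., F(μ, ν*) ≤ F(μ*, ν*) ≤ F(μ*, ν) for all μ ∈ stdSimplex ℝ (Fin m) and ν ∈ stdSimplex ℝ (Fin n)) if and only if μ* i = Real.exp ((∑ j, X i j * ν* j) / β) / ∑ i', Real.exp ((∑ j, X i' j * ν* j) / β) for all i and ν* j = Real.exp (−(∑ i, μ* i * X i j) / α) / ∑ j', Real.exp (−(∑ i, μ* i * X i j') / α) for all j; that is, the quantal response equilibria are exactly the saddle points of the entropy-regularized zero-sum game. -/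

import Mathlib

open Finset Real

/-- Shannon entropy of a finite probability vector (with the convention `0 * log 0 = 0`). -/
noncomputable def shannonEntropy {n : ℕ} (p : Fin n → ℝ) : ℝ :=
  -∑ i, p i * Real.log (p i)

/-- Entropy-regularized zero-sum game objective
`F(μ, ν) = ∑ i, ∑ j, μ i * X i j * ν j + β * H(μ) - α * H(ν)`. -/
noncomputable def entRegObj {m n : ℕ} (X : Matrix (Fin m) (Fin n) ℝ) (β α : ℝ)
    (μ : Fin m → ℝ) (ν : Fin n → ℝ) : ℝ :=
  (∑ i, ∑ j, μ i * X i j * ν j) + β * shannonEntropy μ - α * shannonEntropy ν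

/-- The pointwise inequality behind Gibbs' inequality, with its equality case. -/
theorem sub_le_mul_log_sub_mul_log {p q : ℝ} (hp : 0 ≤ p) (hq : 0 < q) :
    p - q ≤ p * Real.log p - p * Real.log q ∧
      (p - q = p * Real.log p - p * Real.log q → p = q) := by
  rcases hp.eq_or_lt with rfl | hp
  · refine ⟨by simpa using hq.le, fun h => ?_⟩
    simp only [zero_mul, sub_zero, zero_sub, neg_eq_zero] at h
    exact h.symm
  · have key : p * Real.log p - p * Real.log q = -(p * Real.log (q / p)) := by
      rw [Real.log_div hq.ne' hp.ne']
      ring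
    have hmul : p * (q / p - 1) = q - p := by
      field_simp
    rw [key]
    constructor
    · have := mul_le_mul_of_nonneg_left (Real.log_le_sub_one_of_pos (div_pos hq hp)) hp.le
      linarith
    · intro h
      by_contra hne
      have hqp : q / p ≠ 1 := fun h1 => hne ((div_eq_one_iff_eq hp.ne').mp h1).symm
      have := mul_lt_mul_of_pos_left (Real.log_lt_sub_one_of_pos (div_pos hq hp) hqp) hp
      linarith

/-- Gibbs' inequality: relative entropy with respect to a positive vector is nonnegative. -/
theorem sum_mul_log_le_sum_mul_log {ι : Type*} [Fintype ι] {p q : ι → ℝ}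
    (hp : ∀ i, 0 ≤ p i) (hq : ∀ i, 0 < q i) (hpq : ∑ i, p i = ∑ i, q i) :
    ∑ i, p i * Real.log (q i) ≤ ∑ i, p i * Real.log (p i) := by
  have := Finset.sum_le_sum fun i (_ : i ∈ Finset.univ) =>
    (sub_le_mul_log_sub_mul_log (hp i) (hq i)).1
  simp only [Finset.sum_sub_distrib] at this
  linarith

/-- The equality case of Gibbs' inequality. -/
theorem eq_of_sum_mul_log_le {ι : Type*} [Fintype ι] {p q : ι → ℝ}
    (hp : ∀ i, 0 ≤ p i) (hq : ∀ i, 0 < q i) (hpq : ∑ i, p i = ∑ i, q i)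
    (h : ∑ i, p i * Real.log (p i) ≤ ∑ i, p i * Real.log (q i)) (i : ι) : p i = q i := by
  have heq : ∑ i, (p i - q i) = ∑ i, (p i * Real.log (p i) - p i * Real.log (q i)) := by
    simp only [Finset.sum_sub_distrib]
    linarith [sum_mul_log_le_sum_mul_log hp hq hpq]
  exact (sub_le_mul_log_sub_mul_log (hp i) (hq i)).2
    ((Finset.sum_eq_sum_iff_of_le fun i _ =>
      (sub_le_mul_log_sub_mul_log (hp i) (hq i)).1).mp heq i (Finset.mem_univ i))

/-- Gibbs variational principle: the maximizer over the simplex of a linear functional plus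
`t` times the entropy is the softmax of the payoffs at temperature `t`. -/
theorem forall_add_entropy_le_iff_eq_softmax {n : ℕ} (c : Fin n → ℝ) {t : ℝ} (ht : 0 < t)
    {p : Fin n → ℝ} (hp : p ∈ stdSimplex ℝ (Fin n)) :
    (∀ r ∈ stdSimplex ℝ (Fin n),
      ∑ i, r i * c i + t * shannonEntropy r ≤ ∑ i, p i * c i + t * shannonEntropy p) ↔
    ∀ i, p i = Real.exp (c i / t) / ∑ i', Real.exp (c i' / t) := by
  have hne : (Finset.univ : Finset (Fin n)).Nonempty := by
    rw [Finset.nonempty_iff_ne_empty]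
    intro h
    have := hp.2
    simp [h] at this
  set Z := ∑ i', Real.exp (c i' / t) with hZ
  have hZpos : 0 < Z := Finset.sum_pos (fun i _ => Real.exp_pos _) hne
  set q : Fin n → ℝ := fun i => Real.exp (c i / t) / Z with hq
  have hqpos : ∀ i, 0 < q i := fun i => div_pos (Real.exp_pos _) hZpos
  have hqsum : ∑ i, q i = 1 := by
    rw [hq, ← Finset.sum_div, ← hZ, div_self hZpos.ne']
  have hlog : ∀ i, c i = t * Real.log (q i) + t * Real.log Z := by
    intro i
    rw [hq, Real.log_div (Real.exp_pos _).ne' hZpos.ne', Real.log_exp]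
    field_simp
    ring
  have hobj : ∀ r ∈ stdSimplex ℝ (Fin n), ∑ i, r i * c i + t * shannonEntropy r =
      t * Real.log Z + t * (∑ i, r i * Real.log (q i) - ∑ i, r i * Real.log (r i)) := by
    intro r hr
    have : ∑ i, r i * c i = t * ∑ i, r i * Real.log (q i) + (∑ i, r i) * (t * Real.log Z) := by
      rw [Finset.mul_sum, Finset.sum_mul, ← Finset.sum_add_distrib]
      refine Finset.sum_congr rfl fun i _ => ?_
      rw [hlog i]
      ring
    rw [this, hr.2, shannonEntropy]
    ring
  constructor
  · intro h
    have h' := h q ⟨fun i => (hqpos i).le, hqsum⟩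
    rw [hobj q ⟨fun i => (hqpos i).le, hqsum⟩, hobj p hp, sub_self] at h'
    have h0 := le_of_mul_le_mul_left (le_of_add_le_add_left h') ht
    exact eq_of_sum_mul_log_le hp.1 hqpos (hp.2.trans hqsum.symm) (by linarith)
  · intro h r hr
    have hlogp : ∀ i, Real.log (p i) = Real.log (q i) := fun i => congrArg Real.log (h i)
    rw [hobj r hr, hobj p hp]
    simp only [hlogp, sub_self]
    gcongr
    linarith [sum_mul_log_le_sum_mul_log hr.1 hqpos (hr.2.trans hqsum.symm)]

theorem saddle_point_iff_quantal_response_equilibrium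
    (m n : ℕ) (hm : 1 ≤ m) (hn : 1 ≤ n) (X : Matrix (Fin m) (Fin n) ℝ)
    (β α : ℝ) (hβ : 0 < β) (hα : 0 < α)
    (μs : Fin m → ℝ) (νs : Fin n → ℝ)
    (hμs : μs ∈ stdSimplex ℝ (Fin m)) (hνs : νs ∈ stdSimplex ℝ (Fin n)) :
    ((∀ μ ∈ stdSimplex ℝ (Fin m), entRegObj X β α μ νs ≤ entRegObj X β α μs νs) ∧
     (∀ ν ∈ stdSimplex ℝ (Fin n), entRegObj X β α μs νs ≤ entRegObj X β α μs ν)) ↔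
    ((∀ i, μs i = Real.exp ((∑ j, X i j * νs j) / β)
        / ∑ i', Real.exp ((∑ j, X i' j * νs j) / β)) ∧
     (∀ j, νs j = Real.exp (-(∑ i, μs i * X i j) / α)
        / ∑ j', Real.exp (-(∑ i, μs i * X i j') / α))) := by
  have hrow : ∀ μ : Fin m → ℝ, entRegObj X β α μ νs =
      ∑ i, μ i * (∑ j, X i j * νs j) + β * shannonEntropy μ - α * shannonEntropy νs := by
    intro μ
    simp only [entRegObj, Finset.mul_sum, mul_assoc]
  have hcol : ∀ ν : Fin n → ℝ, entRegObj X β α μs ν =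
      β * shannonEntropy μs - (∑ j, ν j * -(∑ i, μs i * X i j) + α * shannonEntropy ν) := by
    intro ν
    have : ∑ j, ν j * -(∑ i, μs i * X i j) = -∑ i, ∑ j, μs i * X i j * ν j := by
      rw [Finset.sum_comm, ← Finset.sum_neg_distrib]
      refine Finset.sum_congr rfl fun j _ => ?_
      rw [mul_neg, mul_comm, Finset.sum_mul]
    rw [this, entRegObj]
    ring
  refine and_congr ?_ ?_
  · rw [← forall_add_entropy_le_iff_eq_softmax (fun i => ∑ j, X i j * νs j) hβ hμs]
    simp only [hrow, sub_le_sub_iff_right]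
  · rw [← forall_add_entropy_le_iff_eq_softmax (fun j => -(∑ i, μs i * X i j)) hα hνs]
    simp only [hcol, sub_le_sub_iff_left]
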